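/- Let b, δ, r, t_1, t_2 be nonnegative integers with δ ≥ 2, gcd(n, t_1) = 1, gcd(n, t_2) < δ and δ + r ≤ n − 1. Set T = {b + i·t_1 + ℓ·t_2 mod n : 0 ≤ i ≤ δ−2, 0 ≤ ℓ ≤ r}, and let T̄ be the smallest union of cosets of the subgroup C_s = {0, μ, …, (s−1)μ} of Z/nZ containing T; say T̄ is a union of exactly t such cosets. Assume T̄ ≠ Z/nZ. Then g := lclm(x − θ^i(β) : i ∈ T̄) has all its coefficients in L (i.e., g ∈ R), g right-divides x^n − 1, and the skew cyclic code C ⊆ L^n defined by g has L-dimension (μ − t)s = n − |T̄| and minimum Hamming distance at least δ + r. -/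

import Mathlib

/-! Skew polynomials over a field `M` twisted by a ring automorphism `θ` (`x·a = θ(a)·x`),
modeled as finitely supported functions `ℕ →₀ M` (coefficient of `xⁱ` at `i`),
with left-coefficient multiplication `(Σᵢ aᵢ xⁱ)·(Σⱼ bⱼ xʲ) = Σᵢⱼ aᵢ θⁱ(bⱼ) x^{i+j}`. -/

variable {M : Type*} [Field M]

/-- Multiplication of skew polynomials: `f * g` in `M[x;θ]`. -/
noncomputable def sMul (θ : M ≃+* M) (f g : ℕ →₀ M) : ℕ →₀ M :=
  f.sum fun i a => g.sum fun j b => Finsupp.single (i + j) (a * (θ ^ i) b)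

/-- The skew polynomial `x - γ`. -/
noncomputable def Xsub (γ : M) : ℕ →₀ M := Finsupp.single 1 1 - Finsupp.single 0 γ

/-- The skew polynomial `xⁿ - 1`. -/
noncomputable def XnSubOne (n : ℕ) : ℕ →₀ M := Finsupp.single n 1 - Finsupp.single 0 1

/-- The left ideal `S·f = {q·f : q ∈ S}` of `S = M[x;θ]`. -/
def lIdeal (θ : M ≃+* M) (f : ℕ →₀ M) : Set (ℕ →₀ M) := {h | ∃ q, h = sMul θ q f}

/-- `g` right-divides `f` in `M[x;θ]`, i.e. `f ∈ S·g`. -/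
def rdvd (θ : M ≃+* M) (g f : ℕ →₀ M) : Prop := f ∈ lIdeal θ g

/-- The fixed subfield of an automorphism. -/
noncomputable def fixedSubfield (φ : M ≃+* M) : Subfield M where
  carrier := {a | φ a = a}
  zero_mem' := map_zero φ
  one_mem' := map_one φ
  add_mem' := by intro a b ha hb; simp only [Set.mem_setOf_eq, map_add] at *; rw [ha, hb]
  mul_mem' := by intro a b ha hb; simp only [Set.mem_setOf_eq, map_mul] at *; rw [ha, hb]
  neg_mem' := by intro a ha; simp only [Set.mem_setOf_eq, map_neg] at *; rw [ha]
  inv_mem' := by intro a ha; simp only [Set.mem_setOf_eq, map_inv₀] at *; rw [ha]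

/-- A skew polynomial lies in the subring `R` of polynomials whose coefficients are fixed
by the automorphism `φ` (for `φ = θ^μ = π`, this is `R = L[x;σ]` with `L = M^π`). -/
def inR (φ : M ≃+* M) (f : ℕ →₀ M) : Prop := ∀ j, φ (f j) = f j

/-- The polynomial of degree `< n` with coefficient vector `c`. -/
noncomputable def vecPoly {n : ℕ} (c : Fin n → M) : ℕ →₀ M :=
  ∑ j : Fin n, Finsupp.single (j : ℕ) (c j)

/-- Hamming weight of a vector. -/
noncomputable def hWt {n : ℕ} (c : Fin n → M) : ℕ := Set.ncard {j : Fin n | c j ≠ 0}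

/-- `α` generates a normal basis `{α, θ(α), …, θ^{n-1}(α)}` of `M` over `K = M^θ`. -/
def NormalBasis (θ : M ≃+* M) (n : ℕ) (α : M) : Prop :=
  LinearIndependent (fixedSubfield θ) (fun i : Fin n => (θ ^ (i : ℕ)) α) ∧
    Submodule.span (fixedSubfield θ) (Set.range fun i : Fin n => (θ ^ (i : ℕ)) α) = ⊤

/-- `f` is monic of degree `d`. -/
def IsMonicAt (f : ℕ →₀ M) (d : ℕ) : Prop := f d = 1 ∧ ∀ j, d < j → f j = 0

/-- `f` is monic. -/
def IsMonic (f : ℕ →₀ M) : Prop := ∃ d, IsMonicAt f d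

/-- Coefficientwise application of an automorphism to a skew polynomial (`f ↦ f^φ`). -/
noncomputable def pmap (φ : M ≃+* M) (f : ℕ →₀ M) : ℕ →₀ M :=
  Finsupp.mapRange φ (map_zero φ) f


/-! ### Evaluation of skew polynomials -/

/-- Operator evaluation of a skew polynomial at `θ^k α`. -/
noncomputable def evK (θ : M ≃+* M) (α : M) (k : ℕ) : (ℕ →₀ M) →+ M :=
  Finsupp.liftAddHom fun i => AddMonoidHom.mulRight ((θ ^ (i + k)) α)

theorem evK_single (θ : M ≃+* M) (α : M) (k i : ℕ) (a : M) :
    evK θ α k (Finsupp.single i a) = a * (θ ^ (i + k)) α := by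
  simp [evK]

/-- `sMul` by a fixed right factor as an additive map. -/
noncomputable def sMulR (θ : M ≃+* M) (g : ℕ →₀ M) : (ℕ →₀ M) →+ (ℕ →₀ M) :=
  Finsupp.liftAddHom fun i =>
    { toFun := fun a => g.sum fun j b => Finsupp.single (i + j) (a * (θ ^ i) b)
      map_zero' := by simp
      map_add' := by
        intro a a'
        simp [add_mul, Finsupp.sum, Finset.sum_add_distrib] }

theorem sMulR_apply (θ : M ≃+* M) (f g : ℕ →₀ M) : sMulR θ g f = sMul θ f g := by
  simp [sMulR, sMul]

theorem pow_add_app (θ : M ≃+* M) (i j : ℕ) (a : M) :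
    (θ ^ (i + j)) a = (θ ^ i) ((θ ^ j) a) := by
  rw [pow_add]; rfl

theorem evK_sMul_single (θ : M ≃+* M) (α : M) (k i : ℕ) (a : M) (g : ℕ →₀ M) :
    evK θ α k (sMul θ (Finsupp.single i a) g) = a * (θ ^ i) (evK θ α k g) := by
  rw [sMul, Finsupp.sum_single_index (by simp)]
  rw [Finsupp.sum, map_sum]
  conv_rhs => rw [← Finsupp.sum_single g, Finsupp.sum, map_sum, map_sum, Finset.mul_sum]
  refine Finset.sum_congr rfl fun j _ => ?_
  rw [evK_single, evK_single, add_assoc, pow_add_app θ i, map_mul]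
  ring

theorem evK_sMul_zero (θ : M ≃+* M) (α : M) (k : ℕ) (q g : ℕ →₀ M)
    (h : evK θ α k g = 0) : evK θ α k (sMul θ q g) = 0 := by
  rw [← sMulR_apply]
  have : ((evK θ α k).comp (sMulR θ g)) = 0 := by
    ext i a
    simp [sMulR_apply, evK_sMul_single, h]
  exact DFunLike.congr_fun this q

theorem exists_div (θ : M ≃+* M) (γ : M) (h : ℕ →₀ M) :
    ∃ q c, h = sMul θ q (Xsub γ) + Finsupp.single 0 c := by
  have hs : ∀ i (a : M), ∃ q c, Finsupp.single i a = sMul θ q (Xsub γ) + Finsupp.single 0 c := by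
    intro i
    induction i with
    | zero => intro a; exact ⟨0, a, by simp [sMul]⟩
    | succ i ih =>
      intro a
      obtain ⟨q, c, hq⟩ := ih (a * (θ ^ i) γ)
      refine ⟨Finsupp.single i a + q, c, ?_⟩
      rw [← sMulR_apply, map_add, add_assoc, sMulR_apply, sMulR_apply, ← hq]
      rw [sMul, Finsupp.sum_single_index (by simp), Xsub, sub_eq_add_neg, ← Finsupp.single_neg,
        Finsupp.sum_add_index' (by simp) (by intros; simp [mul_add]),
        Finsupp.sum_single_index (by simp), Finsupp.sum_single_index (by simp)]
      simp
  induction h using Finsupp.induction_linear with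
  | zero => exact ⟨0, 0, by simp [sMul]⟩
  | add f g hf hg =>
    obtain ⟨q, c, h1⟩ := hf
    obtain ⟨q', c', h2⟩ := hg
    refine ⟨q + q', c + c', ?_⟩
    rw [← sMulR_apply, map_add, sMulR_apply, sMulR_apply, Finsupp.single_add]
    nth_rewrite 1 [h1, h2]
    abel
  | single i a => exact hs i a

theorem mem_lIdeal_Xsub (θ : M ≃+* M) (α β : M) (hα : α ≠ 0) (hβ : β = α⁻¹ * θ α) (k : ℕ)
    (h : ℕ →₀ M) : h ∈ lIdeal θ (Xsub ((θ ^ k) β)) ↔ evK θ α k h = 0 := by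
  have hne : (θ ^ k) α ≠ 0 := (map_ne_zero_iff _ (θ ^ k).injective).mpr hα
  have h0 : evK θ α k (Xsub ((θ ^ k) β)) = 0 := by
    rw [Xsub, map_sub, evK_single, evK_single, hβ, map_mul, map_inv₀, zero_add, add_comm 1 k,
      pow_add_app θ k 1]
    field_simp
    simp
  constructor
  · rintro ⟨q, rfl⟩
    exact evK_sMul_zero θ α k q _ h0
  · intro hz
    obtain ⟨q, c, hq⟩ := exists_div θ ((θ ^ k) β) h
    rw [hq, map_add, evK_sMul_zero θ α k q _ h0, evK_single, zero_add, zero_add] at hz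
    have hc : c = 0 := (mul_eq_zero.mp hz).resolve_right hne
    refine ⟨q, ?_⟩
    rw [hq, hc]; simp

theorem sMul_top (θ : M ≃+* M) (g : ℕ →₀ M) (d : ℕ) (hg : IsMonicAt g d) (q : ℕ →₀ M)
    (hq : ∀ j, d ≤ j → sMul θ q g j = 0) : q = 0 := by
  by_contra hne
  have hsupp : q.support.Nonempty := Finsupp.support_nonempty_iff.mpr hne
  set m := q.support.max' hsupp with hm
  have hmm : m ∈ q.support := Finset.max'_mem _ _
  have h1 := hq (m + d) (by omega)
  rw [sMul, Finsupp.sum, Finsupp.finset_sum_apply, Finset.sum_eq_single m] at h1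
  · rw [Finsupp.sum, Finsupp.finset_sum_apply, Finset.sum_eq_single d] at h1
    · simp [hg.1] at h1
      exact (Finsupp.mem_support_iff.mp hmm) h1
    · intro j _ hj
      rw [Finsupp.single_apply, if_neg (by omega)]
    · intro hd
      simp [hg.1] at hd
  · intro i hi him
    have him' : i ≤ m := Finset.le_max' _ _ hi
    rw [Finsupp.sum, Finsupp.finset_sum_apply]
    refine Finset.sum_eq_zero fun j hj => ?_
    have : j ≤ d := by
      by_contra hlt
      exact (Finsupp.mem_support_iff.mp hj) (hg.2 j (by omega))
    rw [Finsupp.single_apply, if_neg (by omega)]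
  · intro h; exact absurd hmm h

theorem self_mem_lIdeal (θ : M ≃+* M) (g : ℕ →₀ M) : g ∈ lIdeal θ g := by
  refine ⟨Finsupp.single 0 1, ?_⟩
  rw [sMul, Finsupp.sum_single_index (by simp)]
  simp

theorem evK_vecPoly (θ : M ≃+* M) (α : M) (k n : ℕ) (c : Fin n → M) :
    evK θ α k (vecPoly c) = ∑ j : Fin n, c j * (θ ^ ((j : ℕ) + k)) α := by
  rw [vecPoly, map_sum]
  exact Finset.sum_congr rfl fun j _ => evK_single ..

theorem pow_mod_app (θ : M ≃+* M) {n : ℕ} (hord : orderOf θ = n) (k : ℕ) :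
    θ ^ (k % n) = θ ^ k := by
  rw [← hord, pow_mod_orderOf]

theorem evK_congr (θ : M ≃+* M) {n : ℕ} (hord : orderOf θ = n) (α : M) {k k' : ℕ}
    (hk : k % n = k' % n) : evK θ α k = evK θ α k' := by
  ext i a
  have : θ ^ k = θ ^ k' := by rw [← pow_mod_app θ hord k, hk, pow_mod_app θ hord]
  simp [evK_single, pow_add, this]

theorem evK_pmap (θ : M ≃+* M) (α : M) (k μ : ℕ) (h : ℕ →₀ M) :
    evK θ α (k + μ) (pmap (θ ^ μ) h) = (θ ^ μ) (evK θ α k h) := by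
  induction h using Finsupp.induction_linear with
  | zero => simp [pmap]
  | add f g hf hg =>
    have : pmap (θ ^ μ) (f + g) = pmap (θ ^ μ) f + pmap (θ ^ μ) g := by
      ext i; simp [pmap]
    rw [this, map_add, map_add, map_add, hf, hg]
  | single i a =>
    have : pmap (θ ^ μ) (Finsupp.single i a) = Finsupp.single i ((θ ^ μ) a) := by
      simp [pmap]
    rw [this, evK_single, evK_single, map_mul, ← pow_add_app]
    congr 3; ring

/-- Nondegeneracy: Artin/Dedekind independence with the spanning property. -/
theorem eq_zero_of_all (θ : M ≃+* M) {n : ℕ} (hord : orderOf θ = n)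
    (α : M) (hspan : Submodule.span (fixedSubfield θ)
      (Set.range fun i : Fin n => (θ ^ (i : ℕ)) α) = ⊤) (c : Fin n → M)
    (hc : ∀ k < n, ∑ j : Fin n, c j * (θ ^ ((j : ℕ) + k)) α = 0) : c = 0 := by
  have hfix : ∀ (a : fixedSubfield θ) (m : ℕ), (θ ^ m) (a : M) = a := by
    intro a m
    induction m with
    | zero => simp
    | succ m ih =>
      rw [pow_add_app, pow_one, show θ (a : M) = a from a.2, ih]
  have hall : ∀ y : M, ∑ j : Fin n, c j * (θ ^ (j : ℕ)) y = 0 := by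
    intro y
    have hy : y ∈ Submodule.span (fixedSubfield θ)
      (Set.range fun i : Fin n => (θ ^ (i : ℕ)) α) := by rw [hspan]; trivial
    induction hy using Submodule.span_induction with
    | mem x hx =>
      obtain ⟨i, rfl⟩ := hx
      have := hc i i.2
      simpa only [pow_add_app] using this
    | zero => simp
    | add x y _ _ hx hy =>
      simp only [map_add, mul_add, Finset.sum_add_distrib, hx, hy, add_zero]
    | smul a x _ hx =>
      have : ∀ j : Fin n, c j * (θ ^ (j : ℕ)) (a • x) = (a : M) * (c j * (θ ^ (j : ℕ)) x) := by
        intro j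
        rw [Subfield.smul_def, smul_eq_mul, map_mul, hfix]; ring
      simp only [this, ← Finset.mul_sum, hx, mul_zero]
  have hli := linearIndependent_monoidHom M M
  have hinj : Function.Injective
      (fun j : Fin n => (((θ ^ (j : ℕ) : M ≃+* M) : M →+* M) : M →* M)) := by
    intro i j hij
    have h2 : θ ^ (i : ℕ) = θ ^ (j : ℕ) := by
      ext x
      exact DFunLike.congr_fun hij x
    have := pow_injOn_Iio_orderOf (x := θ) (by simp [hord]) (by simp [hord]) h2
    exact Fin.ext this
  have hli2 := hli.comp _ hinj
  rw [Fintype.linearIndependent_iff] at hli2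
  funext j
  refine hli2 c ?_ j
  funext y
  simpa using hall y

/-! ### The Hartmann–Tzeng type argument -/

theorem grow {E : Type*} [AddCommGroup E] [Module M E] [FiniteDimensional M E]
    (F : ℕ → Submodule M E) (hmono : ∀ l, F l ≤ F (l + 1))
    (hst : ∀ l, F (l + 1) = F l → F l = ⊤) (l : ℕ) :
    min (Module.finrank M (F 0) + l) (Module.finrank M E) ≤ Module.finrank M (F l) := by
  induction l with
  | zero => simp
  | succ l ih =>
    by_cases h : F (l + 1) = F l
    · rw [h, hst l h, finrank_top]; exact min_le_right _ _
    · have hlt : F l < F (l + 1) := lt_of_le_of_ne (hmono l) (Ne.symm h)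
      have := Submodule.finrank_lt_finrank_of_lt hlt
      omega

/-- the vectors `(θ^{j+k} α)_j`. -/
def vv (θ : M ≃+* M) (α : M) {n : ℕ} (J : Fin n → Prop) (k : ℕ) : {j : Fin n // J j} → M :=
  fun j => (θ ^ ((j : ℕ) + k)) α

theorem vv_shift (θ : M ≃+* M) (α : M) {n : ℕ} (J : Fin n → Prop) (t : ℕ) (A : Set ℕ)
    (hA : ∀ k ∈ A, vv θ α J (k + t) ∈ Submodule.span M (vv θ α J '' A)) (m k : ℕ)
    (hk : vv θ α J k ∈ Submodule.span M (vv θ α J '' A)) :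
    vv θ α J (k + m * t) ∈ Submodule.span M (vv θ α J '' A) := by
  have hsh : ∀ k, (fun j => (θ ^ t) (vv θ α J k j)) = vv θ α J (k + t) := by
    intro k; funext j
    rw [vv, vv, ← pow_add_app]; congr 2; ring
  have key : ∀ x ∈ Submodule.span M (vv θ α J '' A),
      (fun j => (θ ^ t) (x j)) ∈ Submodule.span M (vv θ α J '' A) := by
    intro x hx
    induction hx using Submodule.span_induction with
    | mem x hx =>
      obtain ⟨k, hk, rfl⟩ := hx
      rw [hsh]; exact hA k hk
    | zero => simp only [Pi.zero_apply, map_zero]; exact Submodule.zero_mem _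
    | add x y _ _ hx hy =>
      simp only [Pi.add_apply, map_add]; exact Submodule.add_mem _ hx hy
    | smul a x _ hx =>
      simp only [Pi.smul_apply, smul_eq_mul, map_mul]
      exact Submodule.smul_mem _ ((θ ^ t) a) hx
  induction m with
  | zero => simpa using hk
  | succ m ih =>
    have := key _ ih
    rw [hsh] at this
    convert this using 2; ring

theorem vv_congr (θ : M ≃+* M) {n : ℕ} (hord : orderOf θ = n) (α : M) (J : Fin n → Prop)
    {k k' : ℕ} (hk : k ≡ k' [MOD n]) : vv θ α J k = vv θ α J k' := by
  funext j
  have : θ ^ k = θ ^ k' := by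
    rw [← pow_mod_app θ hord k, show k % n = k' % n from hk, pow_mod_app θ hord]
  simp only [vv, pow_add, this]

/-- a proper subspace misses some `vv k`. -/
theorem vv_top (θ : M ≃+* M) {n : ℕ} (hord : orderOf θ = n)
    (α : M) (hspan : Submodule.span (fixedSubfield θ)
      (Set.range fun i : Fin n => (θ ^ (i : ℕ)) α) = ⊤) (J : Fin n → Prop)
    (V : Submodule M ({j : Fin n // J j} → M)) (hV : ∀ k, vv θ α J k ∈ V) : V = ⊤ := by
  classical
  by_contra hne
  obtain ⟨f, hf0, hf⟩ := Submodule.exists_le_ker_of_lt_top V (lt_top_iff_ne_top.mpr hne)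
  apply hf0
  have h := eq_zero_of_all θ hord α hspan
    (fun j => if h : J j then f (Pi.single ⟨j, h⟩ 1) else 0) (by
      intro k _
      have h1 : f (vv θ α J k) = 0 := hf (hV k)
      rw [LinearMap.pi_apply_eq_sum_univ] at h1
      refine Eq.trans ?_ h1
      rw [← Finset.sum_filter_add_sum_filter_not Finset.univ J]
      rw [Finset.sum_eq_zero (s := Finset.univ.filter fun j => ¬ J j) (by
        intro j hj; simp at hj; simp [hj]), add_zero]
      rw [Finset.sum_subtype (p := J) _ (by simp)]
      refine Finset.sum_congr rfl fun j _ => ?_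
      rw [dif_pos j.2, smul_eq_mul, mul_comm]
      congr 2
      funext i
      simp [Pi.single_apply, eq_comm])
  apply LinearMap.pi_ext'
  intro j
  ext
  have := congrFun h j
  rw [dif_pos j.2] at this
  simpa using this

theorem cover (n b t₁ t₂ : ℕ) (hn : 0 < n) (ht₁ : Nat.gcd n t₁ = 1) (k : ℕ) :
    ∃ i < Nat.gcd n t₂, ∃ m, b + i * t₁ + m * t₂ ≡ k [MOD n] := by
  set d := Nat.gcd n t₂ with hd
  have hdpos : 0 < d := Nat.gcd_pos_of_pos_left _ hn
  have hdn : d ∣ n := Nat.gcd_dvd_left _ _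
  have hcop : IsCoprime (t₁ : ℤ) (d : ℤ) := by
    rw [Nat.isCoprime_iff_coprime]
    exact (Nat.Coprime.coprime_dvd_left hdn ht₁).symm
  obtain ⟨u, v, huv⟩ := hcop
  have hdz : (0 : ℤ) < d := by exact_mod_cast hdpos
  have hnz : (0 : ℤ) < n := by exact_mod_cast hn
  set i : ℤ := (u * (k - b)) % d with hi
  have hi0 : 0 ≤ i := Int.emod_nonneg _ hdz.ne'
  have hid : i < d := Int.emod_lt_of_pos _ hdz
  have hdiv : (d : ℤ) ∣ (k - b) - i * t₁ := by
    have h1 : i = u * (k - b) - d * ((u * (k - b)) / d) := by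
      have := Int.emod_add_mul_ediv (u * ((k : ℤ) - b)) d
      linarith
    refine ⟨v * (k - b) + ((u * (k - b)) / d) * t₁, ?_⟩
    rw [h1]
    linear_combination (-(k - b : ℤ)) * huv
  obtain ⟨w, hw⟩ := hdiv
  have hbez := Nat.gcd_eq_gcd_ab n t₂
  rw [← hd] at hbez
  set y : ℤ := (Nat.gcdB n t₂) * w with hy
  set m : ℤ := y % n with hm
  have hm0 : 0 ≤ m := Int.emod_nonneg _ hnz.ne'
  refine ⟨i.toNat, by omega, m.toNat, ?_⟩
  rw [← Int.natCast_modEq_iff]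
  push_cast
  rw [Int.toNat_of_nonneg hi0, Int.toNat_of_nonneg hm0]
  rw [Int.modEq_iff_dvd]
  have h2 : m = y - n * (y / n) := by
    have := Int.emod_add_mul_ediv y n
    linarith
  refine ⟨Nat.gcdA n t₂ * w + (y / n) * t₂, ?_⟩
  rw [h2, hy]
  rw [hbez] at hw
  linear_combination hw

theorem HT_bound (θ : M ≃+* M) {n : ℕ} (hn : 0 < n) (hord : orderOf θ = n)
    (α : M) (hspan : Submodule.span (fixedSubfield θ)
      (Set.range fun i : Fin n => (θ ^ (i : ℕ)) α) = ⊤)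
    (b δ r t₁ t₂ : ℕ) (hδ : 2 ≤ δ)
    (ht₁ : Nat.gcd n t₁ = 1) (ht₂ : Nat.gcd n t₂ < δ) (c : Fin n → M) (hc0 : c ≠ 0)
    (hc : ∀ i < δ - 1, ∀ l < r + 1,
      ∑ j : Fin n, c j * (θ ^ ((j : ℕ) + (b + i * t₁ + l * t₂))) α = 0) :
    δ + r ≤ hWt c := by
  classical
  set J : Fin n → Prop := fun j => c j ≠ 0 with hJ
  set v := vv θ α J with hv
  have hw : Module.finrank M ({j : Fin n // J j} → M) = hWt c := by
    rw [Module.finrank_fintype_fun_eq_card, hWt, ← Nat.card_coe_set_eq, Nat.card_eq_fintype_card]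
    rfl
  by_contra hlt
  -- first chain
  let A : ℕ → Set ℕ := fun m => {k | ∃ i < m, k = b + i * t₁}
  let F : ℕ → Submodule M ({j : Fin n // J j} → M) := fun m => Submodule.span M (v '' A m)
  have hF := grow F
    (fun l => Submodule.span_mono (Set.image_mono (by
      rintro k ⟨i, hi, rfl⟩; exact ⟨i, by omega, rfl⟩)))
    (by
      intro l hl
      have hin : ∀ i < l + 1, v (b + i * t₁) ∈ F l := by
        intro i hi
        rw [← hl]
        exact Submodule.subset_span ⟨_, ⟨i, hi, rfl⟩, rfl⟩
      apply vv_top θ hord α hspan J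
      intro k
      obtain ⟨m, hm⟩ : ∃ m, b + m * t₁ ≡ k [MOD n] := by
        obtain ⟨i, hi, m, hm⟩ := cover n b t₁ t₁ hn ht₁ k
        refine ⟨i + m, ?_⟩
        rwa [add_mul, ← add_assoc]
      rw [← vv_congr θ hord α J hm]
      apply vv_shift θ α J t₁ (A l)
      · rintro k ⟨i, hi, rfl⟩
        have := hin (i + 1) (by omega)
        convert this using 2; ring
      · simpa using hin 0 (by omega)) (δ - 1)
  -- second chain
  let B : ℕ → Set ℕ := fun l => {k | ∃ i < δ - 1, ∃ l' < l + 1, k = b + i * t₁ + l' * t₂}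
  let G : ℕ → Submodule M ({j : Fin n // J j} → M) := fun m => Submodule.span M (v '' B m)
  have hG := grow G
    (fun l => Submodule.span_mono (Set.image_mono (by
      rintro k ⟨i, hi, l', hl', rfl⟩; exact ⟨i, hi, l', by omega, rfl⟩)))
    (by
      intro l hl
      have hin : ∀ i < δ - 1, ∀ l' < l + 2, v (b + i * t₁ + l' * t₂) ∈ G l := by
        intro i hi l' hl'
        rw [← hl]
        exact Submodule.subset_span ⟨_, ⟨i, hi, l', hl', rfl⟩, rfl⟩
      apply vv_top θ hord α hspan J
      intro k
      obtain ⟨i, hi, m, hm⟩ := cover n b t₁ t₂ hn ht₁ k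
      rw [← vv_congr θ hord α J hm]
      apply vv_shift θ α J t₂ (B l)
      · rintro k ⟨i, hi, l', hl', rfl⟩
        have := hin i hi (l' + 1) (by omega)
        convert this using 2; ring
      · simpa using hin i (by omega) 0 (by omega)) r
  have hFG : F (δ - 1) ≤ G 0 := Submodule.span_mono (Set.image_mono (by
      rintro k ⟨i, hi, rfl⟩; exact ⟨i, hi, 0, by omega, by simp⟩))
  have hle := Submodule.finrank_mono hFG
  rw [hw] at hF hG
  have hfull : Module.finrank M ({j : Fin n // J j} → M) ≤ Module.finrank M (G r) := by
    rw [hw]; omega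
  have htop : G r = ⊤ := Submodule.eq_top_of_finrank_eq (le_antisymm (Submodule.finrank_le _) hfull)
  -- the functional given by c
  obtain ⟨j₀, hj₀⟩ := Function.ne_iff.mp hc0
  let f : ({j : Fin n // J j} → M) →ₗ[M] M :=
    ∑ j : {j : Fin n // J j}, (c j) • LinearMap.proj j
  have hfv : ∀ x, f x = ∑ j : {j : Fin n // J j}, c j * x j := by
    intro x; simp [f]
  have hker : G r ≤ LinearMap.ker f := by
    refine Submodule.span_le.mpr ?_
    rintro _ ⟨k, ⟨i, hi, l, hl, rfl⟩, rfl⟩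
    rw [SetLike.mem_coe, LinearMap.mem_ker, hfv]
    refine Eq.trans ?_ (hc i hi l hl)
    rw [← Finset.sum_filter_add_sum_filter_not Finset.univ J]
    rw [Finset.sum_eq_zero (s := Finset.univ.filter fun j => ¬ J j) (by
        intro j hj; simp [hJ] at hj; simp [hj]), add_zero]
    rw [Finset.sum_subtype (p := J) _ (by simp)]
    rfl
  have hmem : (Pi.single ⟨j₀, hj₀⟩ 1 : {j : Fin n // J j} → M) ∈ G r := by rw [htop]; trivial
  have h0 := hker hmem
  rw [LinearMap.mem_ker, hfv, Finset.sum_eq_single ⟨j₀, hj₀⟩] at h0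
  · simp at h0; exact hj₀ h0
  · intro j _ hj; simp [Pi.single_apply, hj]
  · simp

/-! ### Dimension -/

theorem fixed_finrank (θ : M ≃+* M) (μ s n : ℕ) (hμ : 0 < μ) (hs : 0 < s) (hn : n = μ * s)
    (hord : orderOf θ = n) :
    FiniteDimensional (fixedSubfield (θ ^ μ)) M ∧
      Module.finrank (fixedSubfield (θ ^ μ)) M = s := by
  have ho : orderOf (θ ^ μ) = s := by
    rw [orderOf_pow_of_dvd hμ.ne' (by rw [hord, hn]; exact dvd_mul_right _ _), hord, hn,
      Nat.mul_div_cancel_left _ hμ]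
  have hfo : IsOfFinOrder (θ ^ μ) := by
    rw [← orderOf_pos_iff, ho]; exact hs
  let H := Subgroup.zpowers (θ ^ μ)
  have hcard : Nat.card H = s := by rw [Nat.card_zpowers, ho]
  haveI : Finite H := Nat.finite_of_card_ne_zero (by omega)
  haveI := Fintype.ofFinite H
  have heq : FixedPoints.subfield H M = fixedSubfield (θ ^ μ) := by
    ext x
    constructor
    · intro hx
      exact hx ⟨θ ^ μ, Subgroup.mem_zpowers _⟩
    · intro hx
      have hx' : (θ ^ μ) ∈ MulAction.stabilizer (M ≃+* M) x := hx
      rintro ⟨h, hh⟩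
      have : H ≤ MulAction.stabilizer (M ≃+* M) x := by
        rw [Subgroup.zpowers_le]; exact hx'
      exact this hh
  rw [← heq]
  refine ⟨inferInstance, ?_⟩
  rw [FixedPoints.finrank_eq_card, ← Nat.card_eq_fintype_card, hcard]

theorem Tbar_mem (T Tbar : Finset ℕ) (μ s n : ℕ) (hμ : 0 < μ) (hs : 0 < s) (hn : n = μ * s)
    (hTn : ∀ τ ∈ T, τ < n)
    (hTbar : Tbar = Finset.image (fun p : ℕ × ℕ => (p.1 + p.2 * μ) % n)
      (T ×ˢ Finset.range s)) (k : ℕ) :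
    k ∈ Tbar ↔ k < n ∧ k % μ ∈ T.image (· % μ) := by
  have hnpos : 0 < n := by rw [hn]; positivity
  rw [hTbar]
  simp only [Finset.mem_image, Finset.mem_product, Finset.mem_range, Prod.exists]
  constructor
  · rintro ⟨τ, m, ⟨hτ, hm⟩, rfl⟩
    refine ⟨Nat.mod_lt _ hnpos, τ, hτ, ?_⟩
    rw [hn, Nat.mod_mod_of_dvd _ (dvd_mul_right _ _)]
    simp
  · rintro ⟨hk, τ, hτ, hmod⟩
    have hτn := hTn τ hτ
    have h1 := Nat.mod_add_div k μ
    have h2 := Nat.mod_add_div τ μ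
    have hq : k / μ < s := by
      rw [Nat.div_lt_iff_lt_mul hμ, mul_comm, ← hn]; exact hk
    have hq2 : τ / μ < s := by
      rw [Nat.div_lt_iff_lt_mul hμ, mul_comm, ← hn]; exact hτn
    generalize k / μ = x at h1 hq
    generalize τ / μ = y at h2 hq2
    by_cases hle : y ≤ x
    · obtain ⟨e, he⟩ := Nat.exists_eq_add_of_le hle
      refine ⟨τ, e, ⟨hτ, by omega⟩, ?_⟩
      have : τ + e * μ = k := by
        rw [he, mul_add, mul_comm μ e] at h1; omega
      rw [this, Nat.mod_eq_of_lt hk]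
    · obtain ⟨e, he⟩ := Nat.exists_eq_add_of_le (show y ≤ x + s by omega)
      refine ⟨τ, e, ⟨hτ, by omega⟩, ?_⟩
      have : τ + e * μ = k + n := by
        have h3 : μ * (x + s) = μ * (y + e) := by rw [he]
        rw [mul_add, mul_add, ← hn, mul_comm μ e] at h3; omega
      rw [this, Nat.add_mod_right, Nat.mod_eq_of_lt hk]

theorem Tbar_card (A Tbar : Finset ℕ) (μ s n : ℕ) (hμ : 0 < μ) (hn : n = μ * s)
    (hA : ∀ a ∈ A, a < μ) (hmem : ∀ k, k ∈ Tbar ↔ k < n ∧ k % μ ∈ A) :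
    Tbar.card = A.card * s := by
  rw [← Finset.card_range s, ← Finset.card_product]
  symm
  refine Finset.card_bij (fun p _ => p.1 + p.2 * μ) ?_ ?_ ?_
  · rintro ⟨a, m⟩ h
    simp only [Finset.mem_product, Finset.mem_range] at h
    have ha := hA a h.1
    rw [hmem]
    refine ⟨?_, ?_⟩
    · have : (m + 1) * μ ≤ s * μ := Nat.mul_le_mul_right _ h.2
      rw [hn, mul_comm μ s]
      simp only
      nlinarith
    · simp [Nat.mod_eq_of_lt ha, h.1]
  · rintro ⟨a, m⟩ h ⟨a', m'⟩ h' heq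
    simp only [Finset.mem_product, Finset.mem_range] at h h'
    have ha := hA a h.1
    have ha' := hA a' h'.1
    simp only at heq
    have e1 : a = a' := by
      have := congrArg (· % μ) heq
      simpa [Nat.mod_eq_of_lt ha, Nat.mod_eq_of_lt ha'] using this
    subst e1
    have : m * μ = m' * μ := by omega
    rw [Nat.eq_of_mul_eq_mul_right hμ this]
  · intro k hk
    rw [hmem] at hk
    refine ⟨(k % μ, k / μ), ?_, ?_⟩
    · simp only [Finset.mem_product, Finset.mem_range]
      refine ⟨hk.2, ?_⟩
      rw [Nat.div_lt_iff_lt_mul hμ, mul_comm, ← hn]; exact hk.1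
    · simp only; rw [mul_comm]; exact Nat.mod_add_div k μ

/-- evaluation shifts by multiples of `μ` on vectors with coefficients in `L`. -/
theorem sum_shift (θ : M ≃+* M) (α : M) (μ n : ℕ) (c : Fin n → M)
    (hc : ∀ j, (θ ^ μ) (c j) = c j) (k m : ℕ)
    (h : ∑ j : Fin n, c j * (θ ^ ((j : ℕ) + k)) α = 0) :
    ∑ j : Fin n, c j * (θ ^ ((j : ℕ) + (k + m * μ))) α = 0 := by
  induction m with
  | zero => simpa using h
  | succ m ih =>
    have := congrArg (θ ^ μ) ih
    rw [map_zero, map_sum] at this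
    rw [← this]
    refine Finset.sum_congr rfl fun j _ => ?_
    rw [map_mul, hc, ← pow_add_app]
    congr 3; ring

/-- the evaluation map `L^n → M^μ`. -/
noncomputable def evL (θ : M ≃+* M) (α : M) (μ n : ℕ) :
    (Fin n → fixedSubfield (θ ^ μ)) →ₗ[fixedSubfield (θ ^ μ)] (Fin μ → M) where
  toFun c k := ∑ j : Fin n, (c j : M) * (θ ^ ((j : ℕ) + (k : ℕ))) α
  map_add' c c' := by
    funext k
    simp [add_mul, Finset.sum_add_distrib]
  map_smul' a c := by
    funext k
    simp [Subfield.smul_def, Finset.mul_sum, mul_assoc]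

theorem dim_aux (θ : M ≃+* M) (μ s n : ℕ)
    (hμ : 0 < μ) (hs : 0 < s) (hn : n = μ * s) (hord : orderOf θ = n)
    (α : M) (hspan : Submodule.span (fixedSubfield θ)
      (Set.range fun i : Fin n => (θ ^ (i : ℕ)) α) = ⊤)
    (A : Finset ℕ) (hA : ∀ a ∈ A, a < μ)
    (C : Submodule (fixedSubfield (θ ^ μ)) (Fin n → M))
    (hC : ∀ c, c ∈ C ↔ (∀ j, (θ ^ μ) (c j) = c j) ∧
      ∀ k ∈ A, ∑ j : Fin n, c j * (θ ^ ((j : ℕ) + k)) α = 0) :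
    Module.finrank (fixedSubfield (θ ^ μ)) C = (μ - A.card) * s := by
  classical
  obtain ⟨hfd, hfr⟩ := fixed_finrank θ μ s n hμ hs hn hord
  let L := fixedSubfield (θ ^ μ)
  have hfr : Module.finrank L M = s := hfr
  have hinj : Function.Injective (evL θ α μ n) := by
    rw [← LinearMap.ker_eq_bot, LinearMap.ker_eq_bot']
    intro c hc
    have h0 := eq_zero_of_all θ hord α hspan (fun j => (c j : M)) (by
      intro k _
      have h1 := sum_shift θ α μ n (fun j => (c j : M)) (fun j => (c j).2) (k % μ) (k / μ)
        (congrFun hc ⟨k % μ, Nat.mod_lt _ hμ⟩)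
      rwa [mul_comm, Nat.mod_add_div] at h1)
    funext j
    exact Subtype.ext (congrFun h0 j)
  have hdim : Module.finrank L (Fin n → L) = Module.finrank L (Fin μ → M) := by
    rw [Module.finrank_fintype_fun_eq_card, Module.finrank_pi_fintype]
    simp [hfr, hn]
  let e := LinearEquiv.ofInjectiveOfFinrankEq (evL θ α μ n) hinj hdim
  have he : ∀ c, e c = evL θ α μ n c := fun c => rfl
  let ext0 : ({k : Fin μ // (k : ℕ) ∉ A} → M) →ₗ[L] (Fin μ → M) :=
    { toFun := fun f k => if h : (k : ℕ) ∉ A then f ⟨k, h⟩ else 0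
      map_add' := by
        intro f g; funext k; simp only [Pi.add_apply]; split_ifs <;> simp
      map_smul' := by
        intro a f; funext k; simp only [Pi.smul_apply, RingHom.id_apply]; split_ifs <;> simp }
  let co : (Fin n → L) →ₗ[L] (Fin n → M) :=
    { toFun := fun c j => (c j : M)
      map_add' := by intro f g; funext k; simp
      map_smul' := by intro a f; funext k; simp [Subfield.smul_def] }
  let ι : ({k : Fin μ // (k : ℕ) ∉ A} → M) →ₗ[L] (Fin n → M) :=
    co ∘ₗ e.symm.toLinearMap ∘ₗ ext0
  have hι : Function.Injective ι := by
    have h1 : Function.Injective co := by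
      intro c c' h; funext j; exact Subtype.ext (congrFun h j)
    have h2 : Function.Injective ext0 := by
      intro f g h
      funext k
      have := congrFun h k
      simpa [ext0, k.2] using this
    exact h1.comp (e.symm.injective.comp h2)
  have hrange : LinearMap.range ι = C := by
    ext c
    rw [hC, LinearMap.mem_range]
    constructor
    · rintro ⟨f, rfl⟩
      refine ⟨fun j => (e.symm (ext0 f) j).2, ?_⟩
      intro k hk
      have h1 : evL θ α μ n (e.symm (ext0 f)) = ext0 f := by
        rw [← he, LinearEquiv.apply_symm_apply]
      have h2 := congrFun h1 ⟨k, hA k hk⟩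
      have h3 : ext0 f ⟨k, hA k hk⟩ = 0 := by simp [ext0, hk]
      rw [h3] at h2
      exact h2
    · rintro ⟨hfix, hz⟩
      let c' : Fin n → L := fun j => ⟨c j, hfix j⟩
      refine ⟨fun k => e c' k, ?_⟩
      have : ext0 (fun k => e c' k) = e c' := by
        funext k
        by_cases hk : (k : ℕ) ∈ A
        · have h1 : e c' k = 0 := hz k hk
          simp [ext0, hk, h1]
        · simp [ext0, hk]
      simp only [ι, LinearMap.comp_apply, this, LinearEquiv.coe_coe, LinearEquiv.symm_apply_apply]
      rfl
  rw [← hrange]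
  rw [LinearMap.finrank_range_of_inj hι, Module.finrank_pi_fintype]
  simp only [hfr, Finset.sum_const, smul_eq_mul, Finset.card_univ]
  congr 1
  rw [Fintype.card_subtype_compl, Fintype.card_fin]
  congr 1
  rw [Fintype.card_subtype]
  refine Finset.card_bij (fun k _ => (k : ℕ)) (by simp) (by
    intro a _ b _ h; exact Fin.ext h) ?_
  intro a ha
  exact ⟨⟨a, hA a ha⟩, by simpa using ha, rfl⟩

/-- **construction of skew cyclic codes with designed distance.**
Setting: `θ` of order `n = μ·s`, `L = M^{θ^μ}`, `R = L[x;σ] ⊆ S = M[x;θ]`, `α` generating a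
normal basis of `M/K` and `β = α⁻¹θ(α)`. Let `b, δ, r, t₁, t₂` be nonnegative integers with
`δ ≥ 2`, `gcd(n, t₁) = 1`, `gcd(n, t₂) < δ` and `δ + r ≤ n - 1`. Set
`T = {b + i·t₁ + ℓ·t₂ mod n : 0 ≤ i ≤ δ-2, 0 ≤ ℓ ≤ r}`, let `T̄` be the smallest union of
cosets of `C_s = {0, μ, …, (s-1)μ} ≤ ℤ/nℤ` containing `T`, a union of exactly `t` cosets
(so `|T̄| = t·s`), and assume `T̄ ≠ ℤ/nℤ`. Then `g = lclm(x - θⁱ(β) : i ∈ T̄)` lies in `R`,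
right-divides `xⁿ - 1`, and the skew cyclic code `C ⊆ Lⁿ` it defines has `L`-dimension
`(μ - t)·s = n - |T̄|` and minimum Hamming distance at least `δ + r`. -/
theorem skew_code_designed_distance {M : Type*} [Field M] (θ : M ≃+* M) (μ s n : ℕ)
    (hμ : 0 < μ) (hs : 0 < s) (hn : n = μ * s) (hord : orderOf θ = n)
    (α : M) (hα : NormalBasis θ n α) (β : M) (hβ : β = α⁻¹ * θ α)
    (b δ r t₁ t₂ : ℕ) (hδ : 2 ≤ δ) (hδr : δ + r ≤ n - 1)
    (ht₁ : Nat.gcd n t₁ = 1) (ht₂ : Nat.gcd n t₂ < δ)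
    (T Tbar : Finset ℕ)
    (hT : T = Finset.image (fun p : ℕ × ℕ => (b + p.1 * t₁ + p.2 * t₂) % n)
      (Finset.range (δ - 1) ×ˢ Finset.range (r + 1)))
    (hTbar : Tbar = Finset.image (fun p : ℕ × ℕ => (p.1 + p.2 * μ) % n)
      (T ×ˢ Finset.range s))
    (hTbarne : Tbar ≠ Finset.range n)
    (t : ℕ) (htcard : Tbar.card = t * s)
    (g : ℕ →₀ M) (hgM : IsMonic g)
    (hggen : lIdeal θ g = ⋂ i ∈ Tbar, lIdeal θ (Xsub ((θ ^ i) β))) :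
    inR (θ ^ μ) g ∧
    rdvd θ g (XnSubOne n) ∧
    (∀ C : Submodule (fixedSubfield (θ ^ μ)) (Fin n → M),
      (C : Set (Fin n → M))
          = {c | (∀ j, (θ ^ μ) (c j) = c j) ∧ rdvd θ g (vecPoly c)} →
        Module.finrank (fixedSubfield (θ ^ μ)) C = (μ - t) * s ∧
        (μ - t) * s = n - Tbar.card) ∧
    (∀ c : Fin n → M, (∀ j, (θ ^ μ) (c j) = c j) → rdvd θ g (vecPoly c) →
      c ≠ 0 → δ + r ≤ hWt c) := by
  have hnpos : 0 < n := by rw [hn]; positivity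
  have hspan := hα.2
  have hα0 : α ≠ 0 := by
    have := hα.1.ne_zero (⟨0, hnpos⟩ : Fin n)
    simpa using this
  have hTn : ∀ τ ∈ T, τ < n := by
    intro τ hτ
    rw [hT, Finset.mem_image] at hτ
    obtain ⟨p, _, rfl⟩ := hτ
    exact Nat.mod_lt _ hnpos
  set A := T.image (· % μ) with hAdef
  have hA : ∀ a ∈ A, a < μ := by
    intro a ha
    rw [hAdef, Finset.mem_image] at ha
    obtain ⟨p, _, rfl⟩ := ha
    exact Nat.mod_lt _ hμ
  have hmem := Tbar_mem T Tbar μ s n hμ hs hn hTn hTbar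
  rw [← hAdef] at hmem
  have hcard := Tbar_card A Tbar μ s n hμ hn hA hmem
  have hAt : A.card = t := by
    rw [htcard] at hcard
    exact (Nat.eq_of_mul_eq_mul_right hs hcard).symm
  have hideal : ∀ h, h ∈ lIdeal θ g ↔ ∀ k ∈ Tbar, evK θ α k h = 0 := by
    intro h
    rw [hggen]
    simp only [Set.mem_iInter]
    exact forall₂_congr fun k _ => mem_lIdeal_Xsub θ α β hα0 hβ k h
  have hgz := (hideal g).mp (self_mem_lIdeal θ g)
  refine ⟨?_, ?_, ?_, ?_⟩
  · obtain ⟨d, hd⟩ := hgM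
    have hp : pmap (θ ^ μ) g - g ∈ lIdeal θ g := by
      rw [hideal]
      intro k hk
      have hk2 := (hmem k).mp hk
      have hk' : (k + (s - 1) * μ) % n ∈ Tbar := by
        rw [hmem]
        refine ⟨Nat.mod_lt _ hnpos, ?_⟩
        rw [hn, Nat.mod_mod_of_dvd _ (dvd_mul_right _ _)]
        simpa using hk2.2
      have hev := evK_congr θ hord α (k := k) (k' := (k + (s - 1) * μ) % n + μ) (by
        rw [Nat.mod_add_mod]
        have : k + (s - 1) * μ + μ = k + n := by
          obtain ⟨s', rfl⟩ : ∃ s', s = s' + 1 := ⟨s - 1, by omega⟩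
          rw [hn, Nat.add_sub_cancel]; ring
        rw [this, Nat.add_mod_right])
      rw [map_sub, hgz k hk, sub_zero, hev, evK_pmap, hgz _ hk', map_zero]
    obtain ⟨q, hq⟩ := hp
    have hq0 : q = 0 := by
      apply sMul_top θ g d hd q
      intro j hj
      rw [← hq]
      rcases eq_or_lt_of_le hj with rfl | hj
      · simp [pmap, hd.1]
      · simp [pmap, hd.2 j hj]
    rw [hq0] at hq
    intro j
    have := DFunLike.congr_fun hq j
    simp [pmap, sMul] at this
    simpa [sub_eq_zero] using this
  · rw [rdvd, hideal]
    intro k _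
    rw [XnSubOne, map_sub, evK_single, evK_single, pow_add, ← hord, pow_orderOf_eq_one]
    simp
  · intro C hC
    refine ⟨?_, ?_⟩
    · rw [← hAt]
      refine dim_aux θ μ s n hμ hs hn hord α hspan A hA C ?_
      intro c
      rw [← SetLike.mem_coe, hC]
      simp only [Set.mem_setOf_eq, rdvd, hideal, evK_vecPoly]
      refine and_congr_right fun hfix => ⟨?_, ?_⟩
      · intro h k hk
        refine h k ((hmem k).mpr ⟨?_, ?_⟩)
        · have := hA k hk
          rw [hn]; nlinarith
        · rwa [Nat.mod_eq_of_lt (hA k hk)]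
      · intro h k hk
        have h1 := sum_shift θ α μ n c hfix (k % μ) (k / μ) (h _ ((hmem k).mp hk).2)
        rwa [mul_comm, Nat.mod_add_div] at h1
    · rw [htcard, Nat.sub_mul, hn]
  · intro c hfix hdvd hc0
    rw [rdvd, hideal] at hdvd
    refine HT_bound θ hnpos hord α hspan b δ r t₁ t₂ hδ ht₁ ht₂ c hc0 ?_
    intro i hi l hl
    have hk : (b + i * t₁ + l * t₂) % n ∈ Tbar := by
      rw [hmem]
      refine ⟨Nat.mod_lt _ hnpos, ?_⟩
      rw [hAdef]
      refine Finset.mem_image_of_mem _ ?_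
      rw [hT]
      exact Finset.mem_image.mpr ⟨(i, l), by simp [hi, hl], rfl⟩
    have := hdvd _ hk
    rw [evK_congr θ hord α (Nat.mod_mod _ _), evK_vecPoly] at this
    exact this
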